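/- arXiv:1412.3465 — 2 statements merged into one kernel-verified Lean document; each statement's English description precedes it below -/
import Mathlib

section
/- Let X and Y be real normed vector spaces, U ⊆ X an open convex set, and F : U → Y a map that is Fréchet differentiable at every point of U, whose derivative DF : U → L(X,Y) satisfies the Lipschitz bound ‖DF(a) − DF(b)‖ ≤ C_DF‖a − b‖ for all a, b ∈ U and some constant C_DF > 0. Let K ⊆ U be a nonempty compact convex set such that F is injective on K, and suppose there exists q₀ > 0 with ‖DF(x)[h]‖ ≥ q₀‖h‖ for every x ∈ K and every h ∈ X. Then there exists a constant C > 0 such that ‖x − y‖ ≤ C‖F(x) − F(y)‖ for all x, y ∈ K. -/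
/-- A differentiable map on a convex set whose derivative is Lipschitz has a quadratic
first-order Taylor remainder. -/
theorem Convex.norm_sub_sub_le_of_lipschitz_hasFDerivAt
    {X Y : Type*} [NormedAddCommGroup X] [NormedSpace ℝ X]
    [NormedAddCommGroup Y] [NormedSpace ℝ Y]
    {s : Set X} (hs : Convex ℝ s) {F : X → Y} {DF : X → X →L[ℝ] Y}
    (hdiff : ∀ x ∈ s, HasFDerivAt F (DF x) x) {C : ℝ} (hC : 0 ≤ C)
    (hlip : ∀ a ∈ s, ∀ b ∈ s, ‖DF a - DF b‖ ≤ C * ‖a - b‖)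
    {x y : X} (hx : x ∈ s) (hy : y ∈ s) :
    ‖F y - F x - DF x (y - x)‖ ≤ C * ‖y - x‖ * ‖y - x‖ := by
  have hseg : segment ℝ x y ⊆ s := hs.segment_subset hx hy
  refine (convex_segment x y).norm_image_sub_le_of_norm_hasFDerivWithin_le'
    (fun z hz => (hdiff z (hseg hz)).hasFDerivWithinAt) (fun z hz => ?_)
    (left_mem_segment ℝ x y) (right_mem_segment ℝ x y)
  refine (hlip z (hseg hz) x hx).trans (mul_le_mul_of_nonneg_left ?_ hC)
  obtain ⟨t, ht, rfl⟩ := (segment_eq_image' ℝ x y) ▸ hz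
  rw [add_sub_cancel_left, norm_smul, Real.norm_of_nonneg ht.1]
  exact mul_le_of_le_one_left (norm_nonneg _) ht.2

/-- A continuous injective map on a compact set has a Lipschitz inverse at large scales. -/
theorem IsCompact.exists_norm_sub_le_of_injOn
    {X Y : Type*} [NormedAddCommGroup X] [NormedAddCommGroup Y]
    {K : Set X} (hK : IsCompact K) {F : X → Y} (hF : ContinuousOn F K)
    (hinj : Set.InjOn F K) {δ : ℝ} (hδ : 0 < δ) :
    ∃ M : ℝ, ∀ x ∈ K, ∀ y ∈ K, δ ≤ ‖x - y‖ → ‖x - y‖ ≤ M * ‖F x - F y‖ := by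
  have hpos : ∀ x ∈ K, ∀ y ∈ K, δ ≤ ‖x - y‖ → 0 < ‖F x - F y‖ := by
    intro x hx y hy hxy
    rw [norm_sub_pos_iff]
    intro h
    rw [hinj hx hy h, sub_self, norm_zero] at hxy
    exact hxy.not_gt hδ
  have hS : IsCompact ((K ×ˢ K) ∩ {p : X × X | δ ≤ ‖p.1 - p.2‖}) :=
    (hK.prod hK).inter_right (isClosed_le continuous_const (by fun_prop))
  have hcont : ContinuousOn (fun p : X × X => ‖p.1 - p.2‖ / ‖F p.1 - F p.2‖)
      ((K ×ˢ K) ∩ {p : X × X | δ ≤ ‖p.1 - p.2‖}) := by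
    have h₁ : ContinuousOn (fun p : X × X => F p.1)
        ((K ×ˢ K) ∩ {p : X × X | δ ≤ ‖p.1 - p.2‖}) :=
      hF.comp continuousOn_fst fun p hp => hp.1.1
    have h₂ : ContinuousOn (fun p : X × X => F p.2)
        ((K ×ˢ K) ∩ {p : X × X | δ ≤ ‖p.1 - p.2‖}) :=
      hF.comp continuousOn_snd fun p hp => hp.1.2
    exact ContinuousOn.div (by fun_prop) (h₁.sub h₂).norm
      fun p hp => (hpos _ hp.1.1 _ hp.1.2 hp.2).ne'
  obtain ⟨M, hM⟩ := hS.exists_bound_of_continuousOn hcont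
  refine ⟨M, fun x hx y hy hxy => ?_⟩
  have h := (Real.le_norm_self _).trans (hM (x, y) ⟨⟨hx, hy⟩, hxy⟩)
  exact (div_le_iff₀ (hpos x hx y hy hxy)).1 h

/-- Abstract Lipschitz stability principle (Bacchelli–Vessella):
if `F` is Fréchet differentiable on an open convex set `U` with Lipschitz
derivative, injective on a nonempty compact convex `K ⊆ U`, and its derivative
is bounded below on `K`, then `F⁻¹` is Lipschitz on `F(K)`. -/
theorem lipschitz_stability
    {X Y : Type*} [NormedAddCommGroup X] [NormedSpace ℝ X]
    [NormedAddCommGroup Y] [NormedSpace ℝ Y]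
    (U : Set X) (hU : IsOpen U) (hUconv : Convex ℝ U)
    (F : X → Y) (DF : X → X →L[ℝ] Y)
    (hdiff : ∀ x ∈ U, HasFDerivAt F (DF x) x)
    (C_DF : ℝ) (hC : 0 < C_DF)
    (hlip : ∀ a ∈ U, ∀ b ∈ U, ‖DF a - DF b‖ ≤ C_DF * ‖a - b‖)
    (K : Set X) (hK : IsCompact K) (hKconv : Convex ℝ K) (hKne : K.Nonempty)
    (hKU : K ⊆ U) (hinj : Set.InjOn F K)
    (q₀ : ℝ) (hq₀ : 0 < q₀)
    (hlow : ∀ x ∈ K, ∀ h : X, q₀ * ‖h‖ ≤ ‖DF x h‖) :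
    ∃ C > 0, ∀ x ∈ K, ∀ y ∈ K, ‖x - y‖ ≤ C * ‖F x - F y‖ := by
  have hcont : ContinuousOn F K := fun x hx =>
    (hdiff x (hKU hx)).continuousAt.continuousWithinAt
  obtain ⟨M, hM⟩ := hK.exists_norm_sub_le_of_injOn hcont hinj
    (show 0 < q₀ / (2 * C_DF) by positivity)
  refine ⟨max (2 / q₀) M, lt_max_of_lt_left (by positivity), fun x hx y hy => ?_⟩
  rcases le_total (q₀ / (2 * C_DF)) ‖x - y‖ with hfar | hnear
  · exact (hM x hx y hy hfar).trans
      (mul_le_mul_of_nonneg_right (le_max_right _ _) (norm_nonneg _))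
  · refine le_trans ?_ (mul_le_mul_of_nonneg_right (le_max_left _ _) (norm_nonneg _))
    have hrem := hUconv.norm_sub_sub_le_of_lipschitz_hasFDerivAt hdiff hC.le hlip
      (hKU hy) (hKU hx)
    have hsmall : C_DF * ‖x - y‖ ≤ q₀ / 2 := by
      rw [le_div_iff₀ (by positivity)] at hnear
      linarith
    have hquad := mul_le_mul_of_nonneg_right hsmall (norm_nonneg (x - y))
    have htri := norm_le_norm_add_norm_sub (F x - F y) (DF y (x - y))
    have hl := hlow y hy (x - y)
    rw [div_mul_eq_mul_div, le_div_iff₀ hq₀]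
    linarith
end

section
/- Let ω ∈ ℝ, let λ₁, μ₁, ρ₁ and λ₂, μ₂, ρ₂ be real constants, and let I = [a₁,b₁]×[a₂,b₂]×[a₃,b₃] ⊂ ℝ³ be a nondegenerate closed box. For k = 1, 2 let u_k : ℝ³ → ℝ³ be twice continuously differentiable on a neighborhood of I and satisfy div σ_k + ρ_k ω² u_k = 0 on I, where σ_k := λ_k (div u_k) I₃ + 2μ_k ∇̂u_k and (div σ)_i := ∑_j ∂σ_{ij}/∂x_j. Then ∫_I [ (λ₁ − λ₂)(div u₁)(div u₂) + 2(μ₁ − μ₂) ∇̂u₁ : ∇̂u₂ − (ρ₁ − ρ₂) ω² u₁·u₂ ] dx = ∑_{i=1}^{3} ( ∫_{face x_i = b_i} (σ₁u₂ − σ₂u₁)_i dS − ∫_{face x_i = a_i} (σ₁u₂ − σ₂u₁)_i dS ), where ∇̂u := (∇u + (∇u)ᵀ)/2, A : B := ∑_{i,j}A_{ij}B_{ij}, (σv)_i := ∑_j σ_{ij}v_j, and each face integral is a two-dimensional Lebesgue integral over the corresponding face. -/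
open MeasureTheory

/-- The entry `(∇u)_{ij} = ∂uᵢ/∂xⱼ` of the Jacobian matrix of a vector field
`u : ℝ³ → ℝ³`. -/
noncomputable def grad3 (u : (Fin 3 → ℝ) → (Fin 3 → ℝ)) (x : Fin 3 → ℝ)
    (i j : Fin 3) : ℝ :=
  fderiv ℝ u x (Pi.single j 1) i

/-- The strain tensor `∇̂u = (∇u + (∇u)ᵀ)/2`. -/
noncomputable def strain3 (u : (Fin 3 → ℝ) → (Fin 3 → ℝ)) (x : Fin 3 → ℝ)
    (i j : Fin 3) : ℝ :=
  (grad3 u x i j + grad3 u x j i) / 2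

/-- The divergence `div u = ∑ᵢ ∂uᵢ/∂xᵢ`. -/
noncomputable def div3 (u : (Fin 3 → ℝ) → (Fin 3 → ℝ)) (x : Fin 3 → ℝ) : ℝ :=
  ∑ i, grad3 u x i i

/-- The isotropic stress field `σ = λ(div u)I₃ + 2μ∇̂u`. -/
noncomputable def stress3 (lam mu : ℝ) (u : (Fin 3 → ℝ) → (Fin 3 → ℝ))
    (x : Fin 3 → ℝ) (i j : Fin 3) : ℝ :=
  lam * div3 u x * (if i = j then (1 : ℝ) else 0) + 2 * mu * strain3 u x i j

/-- The row-wise divergence `(div σ)ᵢ = ∑ⱼ ∂σᵢⱼ/∂xⱼ` of the stress field. -/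
noncomputable def divStress3 (lam mu : ℝ) (u : (Fin 3 → ℝ) → (Fin 3 → ℝ))
    (x : Fin 3 → ℝ) (i : Fin 3) : ℝ :=
  ∑ j, fderiv ℝ (fun y => stress3 lam mu u y i j) x (Pi.single j 1)

/-- The vector `(σv)ᵢ = ∑ⱼ σᵢⱼvⱼ`. -/
noncomputable def stressApply3 (lam mu : ℝ) (u v : (Fin 3 → ℝ) → (Fin 3 → ℝ))
    (x : Fin 3 → ℝ) (i : Fin 3) : ℝ :=
  ∑ j, stress3 lam mu u x i j * v x j

/-- The entries of the gradient of a `C²` field are `C¹`. -/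
theorem contDiffOn_grad3 {V : Set (Fin 3 → ℝ)} (hV : IsOpen V)
    {u : (Fin 3 → ℝ) → (Fin 3 → ℝ)} (hu : ContDiffOn ℝ 2 u V) (i j : Fin 3) :
    ContDiffOn ℝ 1 (fun x => grad3 u x i j) V := by
  have h : ContDiffOn ℝ 1 (fderiv ℝ u) V := hu.fderiv_of_isOpen hV (by norm_num)
  exact contDiffOn_pi.1 (h.clm_apply contDiffOn_const) i

/-- The strain tensor of a `C²` field is `C¹`. -/
theorem contDiffOn_strain3 {V : Set (Fin 3 → ℝ)} (hV : IsOpen V)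
    {u : (Fin 3 → ℝ) → (Fin 3 → ℝ)} (hu : ContDiffOn ℝ 2 u V) (i j : Fin 3) :
    ContDiffOn ℝ 1 (fun x => strain3 u x i j) V :=
  ((contDiffOn_grad3 hV hu i j).add (contDiffOn_grad3 hV hu j i)).div_const 2

/-- The divergence of a `C²` field is `C¹`. -/
theorem contDiffOn_div3 {V : Set (Fin 3 → ℝ)} (hV : IsOpen V)
    {u : (Fin 3 → ℝ) → (Fin 3 → ℝ)} (hu : ContDiffOn ℝ 2 u V) :
    ContDiffOn ℝ 1 (fun x => div3 u x) V :=
  ContDiffOn.sum fun i _ => contDiffOn_grad3 hV hu i i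

/-- The stress field of a `C²` field is `C¹`. -/
theorem contDiffOn_stress3 {V : Set (Fin 3 → ℝ)} (hV : IsOpen V) (lam mu : ℝ)
    {u : (Fin 3 → ℝ) → (Fin 3 → ℝ)} (hu : ContDiffOn ℝ 2 u V) (i j : Fin 3) :
    ContDiffOn ℝ 1 (fun x => stress3 lam mu u x i j) V :=
  ((contDiffOn_const.mul (contDiffOn_div3 hV hu)).mul contDiffOn_const).add
    (contDiffOn_const.mul (contDiffOn_strain3 hV hu i j))

/-- The flux `σv` is `C¹` if `u` and `v` are `C²`. -/
theorem contDiffOn_stressApply3 {V : Set (Fin 3 → ℝ)} (hV : IsOpen V) (lam mu : ℝ)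
    {u v : (Fin 3 → ℝ) → (Fin 3 → ℝ)} (hu : ContDiffOn ℝ 2 u V) (hv : ContDiffOn ℝ 2 v V)
    (i : Fin 3) : ContDiffOn ℝ 1 (fun x => stressApply3 lam mu u v x i) V :=
  ContDiffOn.sum fun j _ => (contDiffOn_stress3 hV lam mu hu i j).mul
    (contDiffOn_pi.1 (hv.of_le (by norm_num)) j)

theorem stress3_comm (lam mu : ℝ) (u : (Fin 3 → ℝ) → (Fin 3 → ℝ)) (x : Fin 3 → ℝ)
    (i j : Fin 3) : stress3 lam mu u x i j = stress3 lam mu u x j i := by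
  simp only [stress3, strain3, eq_comm (a := i), add_comm (grad3 u x i j)]

/-- Product rule `div(σv) = (div σ)·v + σ : ∇̂v`, with `σ : ∇̂v` expanded for the isotropic
stress field `σ`. -/
theorem sum_fderiv_stressApply3 {V : Set (Fin 3 → ℝ)} (hV : IsOpen V) (lam mu : ℝ)
    {u v : (Fin 3 → ℝ) → (Fin 3 → ℝ)} (hu : ContDiffOn ℝ 2 u V) (hv : ContDiffOn ℝ 2 v V)
    {x : Fin 3 → ℝ} (hx : x ∈ V) :
    ∑ i, fderiv ℝ (fun y => stressApply3 lam mu u v y i) x (Pi.single i 1)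
      = ∑ i, divStress3 lam mu u x i * v x i + lam * div3 u x * div3 v x
        + 2 * mu * ∑ i, ∑ j, strain3 u x i j * strain3 v x i j := by
  have hs : ∀ i j, DifferentiableAt ℝ (fun y => stress3 lam mu u y i j) x := fun i j =>
    ((contDiffOn_stress3 hV lam mu hu i j).differentiableOn one_ne_zero).differentiableAt
      (hV.mem_nhds hx)
  have hvx : DifferentiableAt ℝ v x :=
    (hv.differentiableOn two_ne_zero).differentiableAt (hV.mem_nhds hx)
  have hvj : ∀ j, HasFDerivAt (fun y => v y j)
      ((ContinuousLinearMap.proj j).comp (fderiv ℝ v x)) x :=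
    fun j => hasFDerivAt_pi'.1 hvx.hasFDerivAt j
  have key : ∀ i, fderiv ℝ (fun y => stressApply3 lam mu u v y i) x (Pi.single i 1)
      = ∑ j, (stress3 lam mu u x i j * grad3 v x j i
        + v x j * fderiv ℝ (fun y => stress3 lam mu u y j i) x (Pi.single i 1)) := by
    intro i
    have h : HasFDerivAt (fun y => stressApply3 lam mu u v y i) _ x :=
      HasFDerivAt.fun_sum fun j (_ : j ∈ Finset.univ) => (hs i j).hasFDerivAt.mul (hvj j)
    rw [h.fderiv]
    simp [grad3, stress3_comm lam mu u _ i]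
  simp only [key, Finset.sum_add_distrib]
  simp only [divStress3, div3, stress3, strain3, Fin.sum_univ_three]
  simp
  ring

/-- An integral over a box in `Fin 2 → ℝ` as an integral over a product of intervals. -/
theorem setIntegral_Icc_fin_two (a b : Fin 2 → ℝ) (g : (Fin 2 → ℝ) → ℝ) :
    ∫ y in Set.Icc a b, g y
      = ∫ p in Set.Icc (a 0) (b 0) ×ˢ Set.Icc (a 1) (b 1), g ![p.1, p.2] := by
  have h := (volume_preserving_finTwoArrow ℝ).symm
  rw [← h.setIntegral_preimage_emb (MeasurableEquiv.measurableEmbedding _)]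
  congr 2
  ext p
  simp [Pi.le_def, Fin.forall_fin_two, MeasurableEquiv.finTwoArrow, Prod.le_def]

/-- Alessandrini's identity on a rectangular box with constant coefficients:
for solutions `uₖ` of `div σₖ + ρₖω²uₖ = 0`, `k = 1,2`, the volume integral of
`(λ₁−λ₂)(div u₁)(div u₂) + 2(μ₁−μ₂)∇̂u₁:∇̂u₂ − (ρ₁−ρ₂)ω²u₁·u₂` equals the sum
over the faces of the box of the fluxes of `σ₁u₂ − σ₂u₁`. -/
theorem alessandrini_identity_box (ω lam₁ mu₁ rho₁ lam₂ mu₂ rho₂ : ℝ)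
    (a b : Fin 3 → ℝ) (hab : ∀ i, a i < b i)
    (V : Set (Fin 3 → ℝ)) (hV : IsOpen V) (hIV : Set.Icc a b ⊆ V)
    (u₁ u₂ : (Fin 3 → ℝ) → (Fin 3 → ℝ))
    (hu₁ : ContDiffOn ℝ 2 u₁ V) (hu₂ : ContDiffOn ℝ 2 u₂ V)
    (hpde₁ : ∀ x ∈ Set.Icc a b, ∀ i,
      divStress3 lam₁ mu₁ u₁ x i + rho₁ * ω ^ 2 * u₁ x i = 0)
    (hpde₂ : ∀ x ∈ Set.Icc a b, ∀ i,
      divStress3 lam₂ mu₂ u₂ x i + rho₂ * ω ^ 2 * u₂ x i = 0) :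
    (∫ x in Set.Icc a b,
        ((lam₁ - lam₂) * div3 u₁ x * div3 u₂ x
          + 2 * (mu₁ - mu₂) * ∑ i, ∑ j, strain3 u₁ x i j * strain3 u₂ x i j
          - (rho₁ - rho₂) * ω ^ 2 * ∑ i, u₁ x i * u₂ x i))
    = ((∫ p in (Set.Icc (a 1) (b 1)) ×ˢ (Set.Icc (a 2) (b 2)),
          (stressApply3 lam₁ mu₁ u₁ u₂ ![b 0, p.1, p.2] 0
            - stressApply3 lam₂ mu₂ u₂ u₁ ![b 0, p.1, p.2] 0))
        - ∫ p in (Set.Icc (a 1) (b 1)) ×ˢ (Set.Icc (a 2) (b 2)),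
            (stressApply3 lam₁ mu₁ u₁ u₂ ![a 0, p.1, p.2] 0
              - stressApply3 lam₂ mu₂ u₂ u₁ ![a 0, p.1, p.2] 0))
      + ((∫ p in (Set.Icc (a 0) (b 0)) ×ˢ (Set.Icc (a 2) (b 2)),
            (stressApply3 lam₁ mu₁ u₁ u₂ ![p.1, b 1, p.2] 1
              - stressApply3 lam₂ mu₂ u₂ u₁ ![p.1, b 1, p.2] 1))
        - ∫ p in (Set.Icc (a 0) (b 0)) ×ˢ (Set.Icc (a 2) (b 2)),
            (stressApply3 lam₁ mu₁ u₁ u₂ ![p.1, a 1, p.2] 1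
              - stressApply3 lam₂ mu₂ u₂ u₁ ![p.1, a 1, p.2] 1))
      + ((∫ p in (Set.Icc (a 0) (b 0)) ×ˢ (Set.Icc (a 1) (b 1)),
            (stressApply3 lam₁ mu₁ u₁ u₂ ![p.1, p.2, b 2] 2
              - stressApply3 lam₂ mu₂ u₂ u₁ ![p.1, p.2, b 2] 2))
        - ∫ p in (Set.Icc (a 0) (b 0)) ×ˢ (Set.Icc (a 1) (b 1)),
            (stressApply3 lam₁ mu₁ u₁ u₂ ![p.1, p.2, a 2] 2
              - stressApply3 lam₂ mu₂ u₂ u₁ ![p.1, p.2, a 2] 2)) := by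
  have hle : a ≤ b := fun i => (hab i).le
  have hF : ∀ i, ContDiffOn ℝ 1 (fun x => stressApply3 lam₁ mu₁ u₁ u₂ x i
      - stressApply3 lam₂ mu₂ u₂ u₁ x i) V := fun i =>
    (contDiffOn_stressApply3 hV lam₁ mu₁ hu₁ hu₂ i).sub
      (contDiffOn_stressApply3 hV lam₂ mu₂ hu₂ hu₁ i)
  have hdiv : ∀ x ∈ Set.Icc a b,
      ∑ i, fderiv ℝ (fun x => stressApply3 lam₁ mu₁ u₁ u₂ x i
        - stressApply3 lam₂ mu₂ u₂ u₁ x i) x (Pi.single i 1)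
      = (lam₁ - lam₂) * div3 u₁ x * div3 u₂ x
          + 2 * (mu₁ - mu₂) * ∑ i, ∑ j, strain3 u₁ x i j * strain3 u₂ x i j
          - (rho₁ - rho₂) * ω ^ 2 * ∑ i, u₁ x i * u₂ x i := by
    intro x hx
    have hxV := hV.mem_nhds (hIV hx)
    have hsub : ∀ i, fderiv ℝ (fun x => stressApply3 lam₁ mu₁ u₁ u₂ x i
        - stressApply3 lam₂ mu₂ u₂ u₁ x i) x
        = fderiv ℝ (fun y => stressApply3 lam₁ mu₁ u₁ u₂ y i) x
          - fderiv ℝ (fun y => stressApply3 lam₂ mu₂ u₂ u₁ y i) x := fun i =>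
      fderiv_fun_sub
        (((contDiffOn_stressApply3 hV lam₁ mu₁ hu₁ hu₂ i).differentiableOn
          one_ne_zero).differentiableAt hxV)
        (((contDiffOn_stressApply3 hV lam₂ mu₂ hu₂ hu₁ i).differentiableOn
          one_ne_zero).differentiableAt hxV)
    simp only [hsub, sub_apply, Finset.sum_sub_distrib]
    rw [sum_fderiv_stressApply3 hV lam₁ mu₁ hu₁ hu₂ (hIV hx),
      sum_fderiv_stressApply3 hV lam₂ mu₂ hu₂ hu₁ (hIV hx)]
    simp only [fun i => eq_neg_of_add_eq_zero_left (hpde₁ x hx i),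
      fun i => eq_neg_of_add_eq_zero_left (hpde₂ x hx i), Fin.sum_univ_three]
    ring
  have hcont : ContinuousOn (fun x => ∑ i, fderiv ℝ (fun x => stressApply3 lam₁ mu₁ u₁ u₂ x i
      - stressApply3 lam₂ mu₂ u₂ u₁ x i) x (Pi.single i 1)) (Set.Icc a b) :=
    continuousOn_finsetSum _ fun i _ =>
      (((hF i).continuousOn_fderiv_of_isOpen hV le_rfl).mono hIV).clm_apply continuousOn_const
  have hmain := integral_divergence_of_hasFDerivAt_off_countable' a b hle
    (fun i x => stressApply3 lam₁ mu₁ u₁ u₂ x i - stressApply3 lam₂ mu₂ u₂ u₁ x i)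
    (fun i => fderiv ℝ (fun x => stressApply3 lam₁ mu₁ u₁ u₂ x i
      - stressApply3 lam₂ mu₂ u₂ u₁ x i)) ∅ Set.countable_empty
    (fun i => (hF i).continuousOn.mono hIV)
    (fun x hx i => (((hF i).differentiableOn one_ne_zero).differentiableAt (hV.mem_nhds (hIV
      ⟨fun j => (hx.1 j trivial).1.le, fun j => (hx.1 j trivial).2.le⟩))).hasFDerivAt)
    (hcont.integrableOn_compact isCompact_Icc)
  rw [← setIntegral_congr_fun measurableSet_Icc hdiv, hmain]
  have h0 : ∀ t p q : ℝ, (0 : Fin 3).insertNth (α := fun _ => ℝ) t ![p, q] = ![t, p, q] := by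
    intro t p q; ext k; fin_cases k <;> rfl
  have h1 : ∀ t p q : ℝ, (1 : Fin 3).insertNth (α := fun _ => ℝ) t ![p, q] = ![p, t, q] := by
    intro t p q; ext k; fin_cases k <;> rfl
  have h2 : ∀ t p q : ℝ, (2 : Fin 3).insertNth (α := fun _ => ℝ) t ![p, q] = ![p, q, t] := by
    intro t p q; ext k; fin_cases k <;> rfl
  refine (Fin.sum_univ_three _).trans ?_
  simp only [setIntegral_Icc_fin_two, h0, h1, h2]
  rfl
end
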